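/- (Maurey's extension theorem) Let E be a real Banach space and S a closed subspace of E. Suppose T > 0 is such that E satisfies the Rademacher type-2 inequality with constant T for all finite sequences, and C > 0 is such that S (with the induced norm) satisfies the Rademacher cotype-2 inequality with constant C for all finite sequences. Then there exists a bounded linear map P : E → E with P∘P = P, range(P) = S, and operator norm ‖P‖ ≤ T·C. -/

import Mathlib

open Finset

/-- `W` satisfies the Rademacher type-2 inequality for sequences of length `n`
with constant `T`. -/
def RadType2 (W : Type*) [SeminormedAddCommGroup W] (n : ℕ) (T : ℝ) : Prop :=
  ∀ w : Fin n → W,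
    Real.sqrt ((∑ ε : Fin n → Bool, ‖∑ j, if ε j then w j else -w j‖ ^ 2) / 2 ^ n) ≤
      T * Real.sqrt (∑ j, ‖w j‖ ^ 2)

/-- `W` satisfies the Rademacher cotype-2 inequality for sequences of length `n`
with constant `C`. -/
def RadCotype2 (W : Type*) [SeminormedAddCommGroup W] (n : ℕ) (C : ℝ) : Prop :=
  ∀ w : Fin n → W,
    Real.sqrt (∑ j, ‖w j‖ ^ 2) ≤
      C * Real.sqrt ((∑ ε : Fin n → Bool, ‖∑ j, if ε j then w j else -w j‖ ^ 2) / 2 ^ n)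


theorem mx_riesz {F V : Type*} [NormedAddCommGroup F] [NormedSpace ℝ F] [CompleteSpace F]
    [AddCommGroup V] [Module ℝ V] (e : F ≃ₗ[ℝ] V) (B : V →ₗ[ℝ] V →ₗ[ℝ] ℝ)
    (hsymm : ∀ x y, B x y = B y x) (a b : ℝ) (ha : 0 < a)
    (hlow : ∀ x : F, ‖x‖ ^ 2 ≤ a ^ 2 * B (e x) (e x))
    (hup : ∀ x : F, B (e x) (e x) ≤ b ^ 2 * ‖x‖ ^ 2)
    (f : V →ₗ[ℝ] ℝ) (K : ℝ) (hf : ∀ x : F, |f (e x)| ≤ K * ‖x‖) :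
    ∃ v : V, ∀ w, B v w = f w := by
  have hnn : ∀ x : V, 0 ≤ B x x := by
    intro x
    have := hlow (e.symm x)
    simp at this
    by_contra h
    push Not at h
    nlinarith [sq_nonneg ‖e.symm x‖, mul_pos ha ha]
  let cd : InnerProductSpace.Core ℝ V :=
    { inner := fun x y => B x y
      conj_inner_symm := fun x y => by simpa using hsymm y x
      re_inner_nonneg := fun x => by simpa using hnn x
      add_left := fun x y z => by simp
      smul_left := fun x y r => by simp
      definite := fun x hx => by
        have h1 := hlow (e.symm x)
        simp only [LinearEquiv.apply_symm_apply] at h1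
        have hx' : B x x = 0 := hx
        rw [hx'] at h1
        have : ‖e.symm x‖ = 0 := by nlinarith [norm_nonneg (e.symm x)]
        simpa using this }
  let _ : NormedAddCommGroup V := cd.toNormedAddCommGroup
  let _ : InnerProductSpace ℝ V := InnerProductSpace.ofCore cd.toCore
  have hin : ∀ x y : V, inner ℝ x y = B x y := fun x y => rfl
  have hn : ∀ x : V, ‖x‖ ^ 2 = B x x := fun x => by
    rw [← hin, real_inner_self_eq_norm_sq]
  have h1 : ∀ x : F, ‖x‖ ≤ a * ‖e x‖ := fun x => by
    refine le_of_sq_le_sq ?_ (by positivity)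
    rw [mul_pow, hn]; exact hlow x
  have h2 : ∀ x : F, ‖e x‖ ≤ |b| * ‖x‖ := fun x => by
    refine le_of_sq_le_sq ?_ (by positivity)
    rw [mul_pow, hn, sq_abs]; exact hup x
  let e' : F ≃L[ℝ] V :=
    { e with
      continuous_toFun := (LinearMap.mkContinuous e.toLinearMap |b| h2).continuous
      continuous_invFun := (LinearMap.mkContinuous e.symm.toLinearMap a (fun x => by
        simpa using h1 (e.symm x))).continuous }
  have : CompleteSpace V := (completeSpace_congr (e := e'.toEquiv) e'.isUniformEmbedding).1 inferInstance
  let f' : V →L[ℝ] ℝ := LinearMap.mkContinuous f (|K| * a) (fun x => by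
    have := hf (e.symm x)
    have h3 := h1 (e.symm x)
    simp only [LinearEquiv.apply_symm_apply] at this h3
    rw [Real.norm_eq_abs]
    calc _ ≤ _ := this
      _ ≤ |K| * ‖e.symm x‖ := by gcongr; exact le_abs_self K
      _ ≤ |K| * (a * ‖x‖) := by gcongr
      _ = _ := by ring)
  refine ⟨(InnerProductSpace.toDual ℝ V).symm f', fun w => ?_⟩
  rw [← hin, InnerProductSpace.toDual_symm_apply]
  rfl

theorem mx_proj {E : Type*} [NormedAddCommGroup E] [NormedSpace ℝ E] [CompleteSpace E]
    (S : Submodule ℝ E) (hS : IsClosed (S : Set E))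
    (T C : ℝ) (hT : 0 < T) (hC : 0 < C)
    (B : E →ₗ[ℝ] E →ₗ[ℝ] ℝ) (hsymm : ∀ x y, B x y = B y x) (hnn : ∀ x, 0 ≤ B x x)
    (hup : ∀ x, B x x ≤ T ^ 2 * ‖x‖ ^ 2)
    (hlow : ∀ x ∈ S, ‖x‖ ^ 2 ≤ C ^ 2 * B x x) :
    ∃ P : E →L[ℝ] E, P.comp P = P ∧ Set.range P = (S : Set E) ∧ ‖P‖ ≤ T * C := by
  have : CompleteSpace S := hS.completeSpace_coe
  have hCS : ∀ x y, B x y ^ 2 ≤ B x x * B y y := fun x y => by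
    have h : ∀ t : ℝ, 0 ≤ B y y * (t * t) + (2 * B x y) * t + B x x := fun t => by
      have := hnn (x + t • y)
      simp only [map_add, map_smul, LinearMap.add_apply, LinearMap.smul_apply, smul_eq_mul,
        hsymm y x] at this
      linarith
    have := discrim_le_zero h
    rw [discrim] at this
    linarith
  have hCS' : ∀ x y, |B x y| ≤ T ^ 2 * ‖x‖ * ‖y‖ := fun x y => by
    refine le_of_sq_le_sq ?_ (by positivity)
    rw [sq_abs]
    calc _ ≤ _ := hCS x y
      _ ≤ (T ^ 2 * ‖x‖ ^ 2) * (T ^ 2 * ‖y‖ ^ 2) := by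
        gcongr
        · exact hnn y
        · exact hup x
        · exact hup y
      _ = _ := by ring
  have hex : ∀ x : E, ∃ v : S, ∀ w : S, B v w = B x w := fun x => by
    obtain ⟨v, hv⟩ := mx_riesz (LinearEquiv.refl ℝ S) ((B.domRestrict S).compl₂ S.subtype)
      (fun x y => by simp [hsymm]) C T hC
      (fun x => by simpa using hlow x x.2) (fun x => by simpa using hup x)
      ((B x).domRestrict S) (T ^ 2 * ‖x‖) (fun y => by simpa using hCS' x y)
    exact ⟨v, fun w => by simpa using hv w⟩
  choose p hp using hex
  have huniq : ∀ u v : S, (∀ w : S, B u w = B v w) → u = v := fun u v h => by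
    have h1 := hlow (u - v : S) (u - v : S).2
    have h2 : B (u - v : S) (u - v : S) = 0 := by
      have := h (u - v)
      simp only [Submodule.coe_sub, map_sub, LinearMap.sub_apply] at this ⊢
      linarith
    rw [h2] at h1
    have : ‖((u - v : S) : E)‖ = 0 := by
      have := norm_nonneg ((u - v : S) : E)
      nlinarith
    rw [norm_eq_zero] at this
    exact sub_eq_zero.1 (Subtype.ext this)
  let P0 : E →ₗ[ℝ] E :=
    { toFun := fun x => p x
      map_add' := fun x y => by
        rw [← Submodule.coe_add]
        congr 1
        apply huniq
        intro w
        simp [hp]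
      map_smul' := fun r x => by
        rw [RingHom.id_apply, ← Submodule.coe_smul]
        congr 1
        apply huniq
        intro w
        simp [hp] }
  have hb : ∀ x, ‖P0 x‖ ≤ T * C * ‖x‖ := fun x => by
    refine le_of_sq_le_sq ?_ (by positivity)
    have h1 := hlow (p x) (p x).2
    have h2 := hp x (p x)
    have h3 := hCS x (p x)
    have h4 : B (p x) (p x) ≤ B x x := by
      rw [← h2] at h3
      by_contra h
      push Not at h
      have := hnn x
      nlinarith
    change ‖(p x : E)‖ ^ 2 ≤ _
    calc _ ≤ _ := h1
      _ ≤ C ^ 2 * (T ^ 2 * ‖x‖ ^ 2) := by gcongr; exact h4.trans (hup x)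
      _ = _ := by ring
  have hfix : ∀ s : S, p s = s := fun s => huniq _ _ (hp s)
  refine ⟨P0.mkContinuous (T * C) hb, ?_, ?_, LinearMap.mkContinuous_norm_le _ (by positivity) _⟩
  · ext x
    change (p (p x : E) : E) = p x
    rw [hfix]
  · ext x
    constructor
    · rintro ⟨y, rfl⟩
      exact (p y).2
    · intro hx
      refine ⟨x, ?_⟩
      change (p x : E) = x
      have := hfix ⟨x, hx⟩
      exact congrArg Subtype.val this

open TensorProduct in
theorem mx_form {E : Type*} [NormedAddCommGroup E] [NormedSpace ℝ E]
    (S : Submodule ℝ E) (T D : ℝ)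
    (key : ∀ (n : ℕ) (x : Fin n → S) (y z : Fin n → E),
      (∀ ξ : E →L[ℝ] ℝ, ∑ i, ξ (x i) ^ 2 + ∑ i, ξ (z i) ^ 2 = ∑ i, ξ (y i) ^ 2) →
      D * ∑ i, ‖x i‖ ^ 2 ≤ T * ∑ i, ‖y i‖ ^ 2) :
    ∃ B : E →ₗ[ℝ] E →ₗ[ℝ] ℝ, (∀ x y, B x y = B y x) ∧ (∀ x, 0 ≤ B x x) ∧
      (∀ x, B x x ≤ T * ‖x‖ ^ 2) ∧ (∀ x ∈ S, D * ‖x‖ ^ 2 ≤ B x x) := by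
  let G : Set ((E ⊗[ℝ] E) × ℝ) :=
    {p | (∃ y : E, p = (y ⊗ₜ y, T * ‖y‖ ^ 2)) ∨ (∃ x : S, p = (-((x : E) ⊗ₜ (x : E)), -(D * ‖x‖ ^ 2)))
      ∨ (∃ z : E, p = (-(z ⊗ₜ z), 0)) ∨ ∃ x y : E, p = (x ⊗ₜ y - y ⊗ₜ x, 0)}
  let K : PointedCone ℝ ((E ⊗[ℝ] E) × ℝ) := Submodule.span _ G
  let ev : (E →L[ℝ] ℝ) → (E ⊗[ℝ] E) →ₗ[ℝ] ℝ := fun ξ =>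
    TensorProduct.lift ((LinearMap.mul ℝ ℝ).compl₁₂ ξ.toLinearMap ξ.toLinearMap)
  have hev : ∀ ξ x y, ev ξ (x ⊗ₜ y) = ξ x * ξ y := fun ξ x y => by simp [ev]
  have hK : ∀ p ∈ K, ∃ (n : ℕ) (x : Fin n → S) (y z : Fin n → E),
      (∀ ξ, ev ξ p.1 + (∑ i, ξ (x i) ^ 2 + ∑ i, ξ (z i) ^ 2) = ∑ i, ξ (y i) ^ 2) ∧
      T * ∑ i, ‖y i‖ ^ 2 = p.2 + D * ∑ i, ‖x i‖ ^ 2 := by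
    intro p hp
    induction hp using Submodule.span_induction with
    | mem p hp =>
      rcases hp with ⟨y, rfl⟩ | ⟨x, rfl⟩ | ⟨z, rfl⟩ | ⟨x, y, rfl⟩
      · exact ⟨1, 0, fun _ => y, 0, fun ξ => by simp [hev]; ring, by simp⟩
      · exact ⟨1, fun _ => x, 0, 0, fun ξ => by simp [hev]; ring, by simp⟩
      · exact ⟨1, 0, 0, fun _ => z, fun ξ => by simp [hev]; ring, by simp⟩
      · exact ⟨1, 0, 0, 0, fun ξ => by simp [hev]; ring, by simp⟩
    | zero => exact ⟨0, 0, 0, 0, fun ξ => by simp, by simp⟩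
    | add p q _ _ ihp ihq =>
      obtain ⟨n, x, y, z, h1, h2⟩ := ihp
      obtain ⟨m, x', y', z', h1', h2'⟩ := ihq
      refine ⟨n + m, Fin.append x x', Fin.append y y', Fin.append z z', fun ξ => ?_, ?_⟩
      · simp only [Fin.sum_univ_add, Fin.append_left, Fin.append_right, Prod.fst_add, map_add]
        linarith [h1 ξ, h1' ξ]
      · simp only [Fin.sum_univ_add, Fin.append_left, Fin.append_right, Prod.snd_add]
        linarith
    | smul r p _ ih =>
      obtain ⟨n, x, y, z, h1, h2⟩ := ih
      obtain ⟨r, hr⟩ := r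
      have hs : Real.sqrt r ^ 2 = r := Real.sq_sqrt hr
      refine ⟨n, fun i => Real.sqrt r • x i, fun i => Real.sqrt r • y i,
        fun i => Real.sqrt r • z i, fun ξ => ?_, ?_⟩
      · have := h1 ξ
        have e1 : ev ξ ((⟨r, hr⟩ : {c : ℝ // 0 ≤ c}) • p).1 = r * ev ξ p.1 := by
          change ev ξ (r • p.1) = _
          simp
        rw [e1]
        simp only [Submodule.coe_smul, map_smul, smul_eq_mul, mul_pow, hs, ← Finset.mul_sum]
        rw [← this]; ring
      · have e1 : ((⟨r, hr⟩ : {c : ℝ // 0 ≤ c}) • p).2 = r * p.2 := rfl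
        rw [e1]
        simp only [norm_smul, mul_pow, Real.norm_eq_abs, sq_abs, hs, ← Finset.mul_sum]
        linear_combination r * h2
  have hdense : ∀ φ : E ⊗[ℝ] E, ∃ t : ℝ, (φ, t) ∈ K := by
    intro φ
    induction φ using TensorProduct.induction_on with
    | zero => exact ⟨0, K.zero_mem⟩
    | add a b ha hb =>
      obtain ⟨s, hs⟩ := ha
      obtain ⟨t, ht⟩ := hb
      exact ⟨s + t, K.add_mem hs ht⟩
    | tmul x y =>
      have g1 : (((1/2:ℝ) • x + y) ⊗ₜ[ℝ] ((1/2:ℝ) • x + y), T * ‖(1/2:ℝ) • x + y‖ ^ 2) ∈ K :=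
        Submodule.subset_span (Or.inl ⟨_, rfl⟩)
      have g2 : (-(((1/2:ℝ) • x) ⊗ₜ[ℝ] ((1/2:ℝ) • x)), (0:ℝ)) ∈ K :=
        Submodule.subset_span (Or.inr (Or.inr (Or.inl ⟨_, rfl⟩)))
      have g3 : (-(y ⊗ₜ[ℝ] y), (0:ℝ)) ∈ K :=
        Submodule.subset_span (Or.inr (Or.inr (Or.inl ⟨_, rfl⟩)))
      have g4 : (((1/2:ℝ) • x) ⊗ₜ[ℝ] y - y ⊗ₜ[ℝ] ((1/2:ℝ) • x), (0:ℝ)) ∈ K :=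
        Submodule.subset_span (Or.inr (Or.inr (Or.inr ⟨_, _, rfl⟩)))
      refine ⟨T * ‖(1/2:ℝ) • x + y‖ ^ 2, ?_⟩
      convert K.add_mem (K.add_mem g1 g2) (K.add_mem g3 g4) using 1
      ext1
      · simp only [Prod.fst_add, TensorProduct.add_tmul, TensorProduct.tmul_add,
          ← TensorProduct.smul_tmul', TensorProduct.tmul_smul]
        module
      · simp
  let f : ((E ⊗[ℝ] E) × ℝ) →ₗ.[ℝ] ℝ :=
    { domain := LinearMap.range (LinearMap.inr ℝ (E ⊗[ℝ] E) ℝ)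
      toFun := (LinearMap.snd ℝ (E ⊗[ℝ] E) ℝ).domRestrict _ }
  obtain ⟨g, hg1, hg2⟩ := riesz_extension K f (by
    rintro ⟨_, t, rfl⟩ h
    change 0 ≤ t
    obtain ⟨n, x, y, z, h1, h2⟩ := hK _ h
    have := key n x y z (fun ξ => by simpa using h1 ξ)
    have h2 : T * ∑ i, ‖y i‖ ^ 2 = t + D * ∑ i, ‖x i‖ ^ 2 := h2
    linarith) (by
    rintro ⟨φ, s⟩
    obtain ⟨t, ht⟩ := hdense φ
    refine ⟨⟨_, t - s, rfl⟩, ?_⟩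
    simpa using ht)
  have hg3 : ∀ t : ℝ, g (0, t) = t := fun t => hg1 ⟨_, t, rfl⟩
  have hg4 : ∀ φ t, (φ, t) ∈ G → -g (φ, 0) ≤ t := fun φ t h => by
    have := hg2 _ (Submodule.subset_span h)
    have e : ((φ, t) : (E ⊗[ℝ] E) × ℝ) = (φ, 0) + (0, t) := by simp
    rw [e, map_add, hg3] at this
    linarith
  let F : (E ⊗[ℝ] E) →ₗ[ℝ] ℝ := -(g ∘ₗ LinearMap.inl ℝ (E ⊗[ℝ] E) ℝ)
  have hF : ∀ φ t, (φ, t) ∈ G → F φ ≤ t := hg4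
  refine ⟨TensorProduct.curry F, fun x y => ?_, fun x => ?_, fun x => ?_, fun x hx => ?_⟩
  · have h1 := hF _ _ (Or.inr (Or.inr (Or.inr ⟨x, y, rfl⟩)))
    have h2 := hF _ _ (Or.inr (Or.inr (Or.inr ⟨y, x, rfl⟩)))
    simp only [map_sub] at h1 h2
    simp only [TensorProduct.curry_apply]
    linarith
  · have h1 := hF _ _ (Or.inr (Or.inr (Or.inl ⟨x, rfl⟩)))
    simp only [map_neg] at h1
    simp only [TensorProduct.curry_apply]
    linarith
  · exact hF _ _ (Or.inl ⟨x, rfl⟩)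
  · have h1 := hF _ _ (Or.inr (Or.inl ⟨⟨x, hx⟩, rfl⟩))
    simp only [map_neg] at h1
    simp only [TensorProduct.curry_apply]
    simpa using h1

noncomputable def mxI {m : ℕ} (F : EuclideanSpace ℝ (Fin m) → ℝ) : ℝ :=
  ∫ a : EuclideanSpace ℝ (Fin m), max 0 (1 - ‖a‖) * F a

theorem mx_supp {m : ℕ} (F : EuclideanSpace ℝ (Fin m) → ℝ) :
    HasCompactSupport (fun a : EuclideanSpace ℝ (Fin m) => max 0 (1 - ‖a‖) * F a) := by
  apply HasCompactSupport.mul_right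
  apply HasCompactSupport.of_support_subset_isCompact (isCompact_closedBall 0 1)
  intro a ha
  simp only [Function.mem_support] at ha
  rw [mem_closedBall_zero_iff]
  by_contra h
  exact ha (max_eq_left (by linarith))

theorem mx_int {m : ℕ} {F : EuclideanSpace ℝ (Fin m) → ℝ} (hF : Continuous F) :
    MeasureTheory.Integrable (fun a : EuclideanSpace ℝ (Fin m) => max 0 (1 - ‖a‖) * F a) :=
  Continuous.integrable_of_hasCompactSupport (by fun_prop) (mx_supp F)

theorem mxI_mono {m : ℕ} {F G : EuclideanSpace ℝ (Fin m) → ℝ} (hF : Continuous F)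
    (hG : Continuous G) (h : ∀ a, F a ≤ G a) : mxI F ≤ mxI G :=
  MeasureTheory.integral_mono (mx_int hF) (mx_int hG) (fun a =>
    mul_le_mul_of_nonneg_left (h a) (le_max_left _ _))

theorem mxI_sum {m : ℕ} {ι : Type*} (s : Finset ι) {F : ι → EuclideanSpace ℝ (Fin m) → ℝ}
    (hF : ∀ i, Continuous (F i)) : mxI (fun a => ∑ i ∈ s, F i a) = ∑ i ∈ s, mxI (F i) := by
  unfold mxI
  rw [← MeasureTheory.integral_finsetSum _ (fun i _ => mx_int (hF i))]
  simp only [Finset.mul_sum]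

theorem mxI_smul {m : ℕ} (r : ℝ) (F : EuclideanSpace ℝ (Fin m) → ℝ) :
    mxI (fun a => r * F a) = r * mxI F := by
  unfold mxI
  rw [← MeasureTheory.integral_const_mul]
  congr 1; ext a; ring

theorem mxI_iso {m : ℕ} (U : EuclideanSpace ℝ (Fin m) ≃ₗᵢ[ℝ] EuclideanSpace ℝ (Fin m))
    (F : EuclideanSpace ℝ (Fin m) → ℝ) : mxI (fun a => F (U a)) = mxI F := by
  unfold mxI
  have := (U.measurePreserving).integral_comp U.toHomeomorph.measurableEmbedding
    (fun a => max 0 (1 - ‖a‖) * F a)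
  simpa using this

theorem mxI_coord_eq {m : ℕ} (i j : Fin m) :
    mxI (fun a : EuclideanSpace ℝ (Fin m) => a i ^ 2) = mxI (fun a => a j ^ 2) := by
  rw [← mxI_iso (LinearIsometryEquiv.piLpCongrLeft 2 ℝ ℝ (Equiv.swap i j)) (fun a => a j ^ 2)]
  simp [LinearIsometryEquiv.piLpCongrLeft_apply, Equiv.piCongrLeft'_apply]

theorem mxI_coord_pos {m : ℕ} (i : Fin m) :
    0 < mxI (fun a : EuclideanSpace ℝ (Fin m) => a i ^ 2) := by
  apply Continuous.integral_pos_of_hasCompactSupport_nonneg_nonzero (by fun_prop) (mx_supp _)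
    (x := EuclideanSpace.single i (1/2 : ℝ))
  · intro a
    exact mul_nonneg (le_max_left _ _) (sq_nonneg _)
  · simp
    norm_num

theorem mx_const (m : ℕ) : ∃ c : ℝ, 0 < c ∧ ∀ i : Fin m,
    mxI (fun a : EuclideanSpace ℝ (Fin m) => a i ^ 2) = c := by
  rcases m with _ | m
  · exact ⟨1, one_pos, fun i => i.elim0⟩
  · exact ⟨_, mxI_coord_pos 0, fun i => mxI_coord_eq i 0⟩

/-- sign flips -/
noncomputable def mxFlip {m : ℕ} (ε : Fin m → Bool) :
    EuclideanSpace ℝ (Fin m) ≃ₗᵢ[ℝ] EuclideanSpace ℝ (Fin m) :=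
  LinearIsometryEquiv.piLpCongrRight 2 (fun i =>
    if ε i then LinearIsometryEquiv.refl ℝ ℝ else LinearIsometryEquiv.neg ℝ)

theorem mxFlip_apply {m : ℕ} (ε : Fin m → Bool) (a : EuclideanSpace ℝ (Fin m)) (i : Fin m) :
    mxFlip ε a i = if ε i then a i else - a i := by
  simp only [mxFlip, LinearIsometryEquiv.piLpCongrRight_apply]
  split_ifs <;> simp

section
variable {W : Type*} [NormedAddCommGroup W] [NormedSpace ℝ W]

theorem mx_flip_sum {m : ℕ} (w : Fin m → W) (ε : Fin m → Bool) :
    mxI (fun a => ‖∑ j, if ε j then a j • w j else -(a j • w j)‖ ^ 2) =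
      mxI (fun a => ‖∑ j, a j • w j‖ ^ 2) := by
  rw [← mxI_iso (mxFlip ε) (fun a => ‖∑ j, a j • w j‖ ^ 2)]
  congr 1; ext a
  congr 2
  refine Finset.sum_congr rfl fun j _ => ?_
  rw [mxFlip_apply]
  split_ifs <;> simp

theorem mx_avg {m : ℕ} (w : Fin m → W) :
    mxI (fun a => (∑ ε : Fin m → Bool, ‖∑ j, if ε j then a j • w j else -(a j • w j)‖ ^ 2) / 2 ^ m)
      = mxI (fun a => ‖∑ j, a j • w j‖ ^ 2) := by
  simp only [div_eq_inv_mul]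
  rw [mxI_smul, mxI_sum]
  · simp only [mx_flip_sum]
    simp
  · intro ε
    refine Continuous.pow (Continuous.norm (continuous_finsetSum _ fun j _ => ?_)) 2
    split_ifs <;> fun_prop

theorem mx_avg_cont {m : ℕ} (w : Fin m → W) : Continuous (fun a : EuclideanSpace ℝ (Fin m) =>
    (∑ ε : Fin m → Bool, ‖∑ j, if ε j then a j • w j else -(a j • w j)‖ ^ 2) / 2 ^ m) := by
  refine Continuous.div_const (continuous_finsetSum _ fun ε _ =>
    Continuous.pow (Continuous.norm (continuous_finsetSum _ fun j _ => ?_)) 2) _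
  split_ifs <;> fun_prop

theorem mx_sq {m : ℕ} (w : Fin m → W) {c : ℝ}
    (hc : ∀ i : Fin m, mxI (fun a : EuclideanSpace ℝ (Fin m) => a i ^ 2) = c) :
    mxI (fun a : EuclideanSpace ℝ (Fin m) => ∑ j, ‖a j • w j‖ ^ 2) = c * ∑ j, ‖w j‖ ^ 2 := by
  rw [mxI_sum _ (fun j => by fun_prop), Finset.mul_sum]
  refine Finset.sum_congr rfl fun j _ => ?_
  rw [← hc j, mul_comm, ← mxI_smul]
  congr 1; ext a
  rw [norm_smul, mul_pow, Real.norm_eq_abs, sq_abs, mul_comm]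

theorem mx_type {m : ℕ} {T : ℝ} (h : RadType2 W m T) (w : Fin m → W) {c : ℝ}
    (hc : ∀ i : Fin m, mxI (fun a : EuclideanSpace ℝ (Fin m) => a i ^ 2) = c) :
    mxI (fun a => ‖∑ j, a j • w j‖ ^ 2) ≤ T ^ 2 * (c * ∑ j, ‖w j‖ ^ 2) := by
  rw [← mx_avg, ← mx_sq w hc, ← mxI_smul]
  refine mxI_mono (mx_avg_cont w) (by fun_prop) fun a => ?_
  have := h (fun j => a j • w j)
  have h2 := pow_le_pow_left₀ (Real.sqrt_nonneg _) this 2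
  rwa [mul_pow, Real.sq_sqrt (by positivity), Real.sq_sqrt (by positivity)] at h2

theorem mx_cotype {m : ℕ} {C : ℝ} (h : RadCotype2 W m C) (w : Fin m → W) {c : ℝ}
    (hc : ∀ i : Fin m, mxI (fun a : EuclideanSpace ℝ (Fin m) => a i ^ 2) = c) :
    c * ∑ j, ‖w j‖ ^ 2 ≤ C ^ 2 * mxI (fun a => ‖∑ j, a j • w j‖ ^ 2) := by
  rw [← mx_avg, ← mx_sq w hc, ← mxI_smul]
  refine mxI_mono (by fun_prop) ((mx_avg_cont w).const_mul _) fun a => ?_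
  have := h (fun j => a j • w j)
  have h2 := pow_le_pow_left₀ (Real.sqrt_nonneg _) this 2
  rwa [mul_pow, Real.sq_sqrt (by positivity), Real.sq_sqrt (by positivity)] at h2

theorem mx_drop {m : ℕ} (w : Fin m → W) (ε : Fin m → Bool) :
    mxI (fun a => ‖∑ j, a j • (if ε j then w j else 0)‖ ^ 2) ≤
      mxI (fun a => ‖∑ j, a j • w j‖ ^ 2) := by
  have h1 : ∀ a : EuclideanSpace ℝ (Fin m), ‖∑ j, a j • (if ε j then w j else 0)‖ ^ 2 ≤
      ∑ b : Bool, 2⁻¹ * ‖∑ j, if (ε j || b) then a j • w j else -(a j • w j)‖ ^ 2 := by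
    intro a
    simp only [Fintype.sum_bool, Bool.or_true, Bool.or_false, if_true]
    have e : ∑ j, a j • (if ε j then w j else 0) = (2⁻¹ : ℝ) • (∑ j, a j • w j +
        ∑ j, if ε j then a j • w j else -(a j • w j)) := by
      rw [← Finset.sum_add_distrib, Finset.smul_sum]
      refine Finset.sum_congr rfl fun j _ => ?_
      split_ifs
      · module
      · simp
    rw [e, norm_smul]
    have h3 := norm_add_le (∑ j, a j • w j) (∑ j, if ε j then a j • w j else -(a j • w j))
    have h4 := pow_le_pow_left₀ (norm_nonneg _) h3 2
    rw [mul_pow]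
    norm_num
    nlinarith [sq_nonneg (‖∑ j, a j • w j‖ - ‖∑ j, if ε j then a j • w j else -(a j • w j)‖)]
  have hcont : ∀ b : Bool, Continuous (fun a : EuclideanSpace ℝ (Fin m) =>
      2⁻¹ * ‖∑ j, if (ε j || b) then a j • w j else -(a j • w j)‖ ^ 2) := fun b => by
    refine Continuous.const_mul
      (Continuous.pow (Continuous.norm (continuous_finsetSum _ fun j _ => ?_)) 2) _
    split_ifs <;> fun_prop
  refine (mxI_mono (by fun_prop) (continuous_finsetSum _ fun b _ => hcont b) h1).trans ?_
  rw [mxI_sum _ hcont]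
  simp only [mxI_smul, mx_flip_sum w (fun j => ε j || _)]
  simp

theorem mx_ext {D H : Type*} [AddCommGroup D] [Module ℝ D] [NormedAddCommGroup H]
    [InnerProductSpace ℝ H] [FiniteDimensional ℝ H] (Y Z : D →ₗ[ℝ] H) (hn : ∀ ξ, ‖Z ξ‖ = ‖Y ξ‖) :
    ∃ U : H ≃ₗᵢ[ℝ] H, ∀ ξ, U (Y ξ) = Z ξ := by
  obtain ⟨s, hs⟩ := (Y).rangeRestrict.exists_rightInverse_of_surjective
    (LinearMap.range_rangeRestrict _)
  have hs' : ∀ u, Y (s u) = u := fun u => congrArg Subtype.val (LinearMap.congr_fun hs u)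
  let L : LinearMap.range (Y) →ₗᵢ[ℝ] H :=
    { toLinearMap := Z ∘ₗ s
      norm_map' := fun u => by
        rw [LinearMap.comp_apply, hn, hs']; rfl }
  let U := L.extend.toLinearIsometryEquiv rfl
  refine ⟨U, fun ξ => ?_⟩
  have h1 : U (Y ξ) = L ⟨Y ξ, ξ, rfl⟩ := L.extend_apply ⟨Y ξ, ξ, rfl⟩
  rw [h1]
  change Z (s _) = _
  rw [← sub_eq_zero, ← map_sub, ← norm_eq_zero, hn, map_sub, hs', sub_self, norm_zero]

theorem mx_rot {m : ℕ} (w y : Fin m → W)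
    (h : ∀ ξ : W →L[ℝ] ℝ, ∑ i, ξ (w i) ^ 2 = ∑ i, ξ (y i) ^ 2) :
    mxI (fun a => ‖∑ j, a j • w j‖ ^ 2) = mxI (fun a => ‖∑ j, a j • y j‖ ^ 2) := by
  let mk : (Fin m → W) → (W →L[ℝ] ℝ) →ₗ[ℝ] EuclideanSpace ℝ (Fin m) := fun v =>
    { toFun := fun ξ => WithLp.toLp 2 (fun i => ξ (v i))
      map_add' := fun ξ η => by ext i; simp
      map_smul' := fun r ξ => by ext i; simp }
  have hmk : ∀ v ξ i, mk v ξ i = ξ (v i) := fun v ξ i => rfl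
  have hn : ∀ ξ, ‖mk w ξ‖ = ‖mk y ξ‖ := fun ξ => by
    simp only [EuclideanSpace.norm_eq, hmk, Real.norm_eq_abs, sq_abs, h]
  obtain ⟨U, hU⟩ := mx_ext (mk y) (mk w) hn
  have hlin : ∀ v ξ (a : EuclideanSpace ℝ (Fin m)), ξ (∑ j, a j • v j) = inner ℝ a (mk v ξ) := by
    intro v ξ a
    simp [PiLp.inner_apply, hmk, mul_comm]
  rw [← mxI_iso U]
  congr 1; ext a
  congr 2
  refine (SeparatingDual.eq_iff_forall_dual_eq (R := ℝ)).2 fun ξ => ?_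
  rw [hlin, hlin, ← hU, U.inner_map_map]

end

theorem mx_key {E : Type*} [NormedAddCommGroup E] [NormedSpace ℝ E]
    (S : Submodule ℝ E) (T C : ℝ) (hC : 0 < C)
    (htype : ∀ n : ℕ, RadType2 E n T) (hcot : ∀ n : ℕ, RadCotype2 S n C)
    (n : ℕ) (x : Fin n → S) (y z : Fin n → E)
    (h : ∀ ξ : E →L[ℝ] ℝ, ∑ i, ξ (x i) ^ 2 + ∑ i, ξ (z i) ^ 2 = ∑ i, ξ (y i) ^ 2) :
    (C ^ 2)⁻¹ * ∑ i, ‖x i‖ ^ 2 ≤ T ^ 2 * ∑ i, ‖y i‖ ^ 2 := by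
  obtain ⟨c, hc0, hc⟩ := mx_const (n + n)
  let w : Fin (n + n) → E := Fin.append (fun i => (x i : E)) z
  let x' : Fin (n + n) → S := Fin.append x 0
  let y' : Fin (n + n) → E := Fin.append y 0
  let ε : Fin (n + n) → Bool := Fin.append (fun _ => true) (fun _ => false)
  have hx' : ∀ j, ((x' j : S) : E) = if ε j then w j else 0 := by
    intro j
    refine Fin.addCases (fun i => ?_) (fun i => ?_) j <;> simp [x', ε, w, -Fin.natAdd_eq_addNat]
  have h1 := mx_cotype (hcot (n + n)) x' hc
  have h2 := mx_type (htype (n + n)) y' hc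
  have h3 := mx_drop w ε
  have h4 := mx_rot w y' (fun ξ => by simp [w, y', Fin.sum_univ_add, h, -Fin.natAdd_eq_addNat])
  have h5 : mxI (fun a => ‖∑ j, a j • x' j‖ ^ 2) =
      mxI (fun a => ‖∑ j, a j • (if ε j then w j else 0)‖ ^ 2) := by
    congr 1; ext a
    rw [Submodule.coe_norm]
    simp only [Submodule.coe_sum, Submodule.coe_smul, hx']
  have h6 : ∑ j, ‖x' j‖ ^ 2 = ∑ i, ‖x i‖ ^ 2 := by simp [x', Fin.sum_univ_add, -Fin.natAdd_eq_addNat]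
  have h7 : ∑ j, ‖y' j‖ ^ 2 = ∑ i, ‖y i‖ ^ 2 := by simp [y', Fin.sum_univ_add, -Fin.natAdd_eq_addNat]
  rw [h6, h5] at h1
  rw [h7] at h2
  rw [inv_mul_le_iff₀ (by positivity)]
  refine le_of_mul_le_mul_left ?_ hc0
  calc _ ≤ _ := h1
    _ ≤ C ^ 2 * (T ^ 2 * (c * ∑ i, ‖y i‖ ^ 2)) := by
      gcongr; exact h3.trans (h4.le.trans h2)
    _ = _ := by ring

/-- Maurey's extension theorem. -/
theorem stmt17 {E : Type*} [NormedAddCommGroup E] [NormedSpace ℝ E] [CompleteSpace E]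
    (S : Submodule ℝ E) (hS : IsClosed (S : Set E))
    (T C : ℝ) (hT : 0 < T) (hC : 0 < C)
    (htype : ∀ n : ℕ, RadType2 E n T)
    (hcot : ∀ n : ℕ, RadCotype2 S n C) :
    ∃ P : E →L[ℝ] E, P.comp P = P ∧ Set.range P = (S : Set E) ∧ ‖P‖ ≤ T * C := by
  obtain ⟨B, h1, h2, h3, h4⟩ := mx_form S (T ^ 2) ((C ^ 2)⁻¹)
    (mx_key S T C hC htype hcot)
  refine mx_proj S hS T C hT hC B h1 h2 h3 fun x hx => ?_
  have := h4 x hx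
  rwa [inv_mul_le_iff₀ (by positivity)] at this
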